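/- arXiv:nlin/0012063 — 2 statements merged into one kernel-verified Lean document; each statement's English description precedes it below -/
import Mathlib

section
/- For each i ∈ ℤ/3ℤ, the Bäcklund transformations s_i and s_{i+1} of the q-Painlevé IV symmetric form satisfy the braid relation: for a = (a₀,a₁,a₂) ∈ (ℂ∖{0})³ and f = (f₀,f₁,f₂) ∈ ℂ³ such that all denominators arising in the successive applications below are nonzero, one has s_i(s_{i+1}(s_i(a,f))) = s_{i+1}(s_i(s_{i+1}(a,f))); together with the involutivity of each s_j this expresses the affine Weyl group relation (s_i s_{i+1})³ = 1. -/
noncomputable section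

/-- The type `A₂⁽¹⁾` generalized Cartan matrix. -/
def cartanA2 (i j : ZMod 3) : ℤ := if i = j then 2 else -1

/-- An orientation matrix of the `A₂⁽¹⁾` Dynkin diagram. -/
def orientA2 (i j : ZMod 3) : ℤ := if i = j then 0 else if j = i + 1 then 1 else -1

/-- The Bäcklund transformation `sᵢ` of the symmetric form of q-Painlevé IV. -/
def sBT (i : ZMod 3) (p : (ZMod 3 → ℂ) × (ZMod 3 → ℂ)) : (ZMod 3 → ℂ) × (ZMod 3 → ℂ) :=
  (fun j => p.1 j * p.1 i ^ (-(cartanA2 i j)),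
   fun j => p.2 j * ((p.1 i + p.2 i) / (1 + p.1 i * p.2 i)) ^ (orientA2 i j))

/-- The denominators (and the factor raised to a negative power) arising when applying `sᵢ`
are nonzero. -/
def okBT (i : ZMod 3) (p : (ZMod 3 → ℂ) × (ZMod 3 → ℂ)) : Prop :=
  1 + p.1 i * p.2 i ≠ 0 ∧ p.1 i + p.2 i ≠ 0

/-- The factor by which `sᵢ` multiplies `f_{i+1}`, and divides `f_{i-1}`. -/
def ratioBT (i : ZMod 3) (p : (ZMod 3 → ℂ) × (ZMod 3 → ℂ)) : ℂ :=
  (p.1 i + p.2 i) / (1 + p.1 i * p.2 i)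

lemma sBT_fst_self (i : ZMod 3) (p : (ZMod 3 → ℂ) × (ZMod 3 → ℂ)) :
    (sBT i p).1 i = (p.1 i)⁻¹ := by
  rcases eq_or_ne (p.1 i) 0 with h | h
  · simp [sBT, h]
  · simp only [sBT, cartanA2, if_true, zpow_neg]
    field_simp

lemma sBT_fst_of_ne {i j : ZMod 3} (hij : i ≠ j) (p : (ZMod 3 → ℂ) × (ZMod 3 → ℂ)) :
    (sBT i p).1 j = p.1 j * p.1 i := by
  simp [sBT, cartanA2, hij]

lemma sBT_snd_self (i : ZMod 3) (p : (ZMod 3 → ℂ) × (ZMod 3 → ℂ)) :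
    (sBT i p).2 i = p.2 i := by
  simp [sBT, orientA2]

lemma sBT_snd_succ {i j : ZMod 3} (hij : j = i + 1) (p : (ZMod 3 → ℂ) × (ZMod 3 → ℂ)) :
    (sBT i p).2 j = p.2 j * ratioBT i p := by
  simp [sBT, orientA2, ratioBT, hij]

lemma sBT_snd_pred {i j : ZMod 3} (hij : i = j + 1) (p : (ZMod 3 → ℂ) × (ZMod 3 → ℂ)) :
    (sBT i p).2 j = p.2 j / ratioBT i p := by
  have h : j ≠ j + 1 + 1 := by decide +revert
  simp [sBT, orientA2, ratioBT, hij, h, div_eq_mul_inv]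

lemma ratioBT_sBT_pred {i j : ZMod 3} (hij : j = i + 1)
    (p : (ZMod 3 → ℂ) × (ZMod 3 → ℂ)) (h : okBT i p) :
    ratioBT j (sBT i p) =
      (p.1 i * p.1 j * (1 + p.1 i * p.2 i) + p.2 j * (p.1 i + p.2 i)) /
        (1 + p.1 i * p.2 i + p.1 i * p.1 j * p.2 j * (p.1 i + p.2 i)) := by
  have hne : i ≠ j := by simp [hij]
  have h' := h.1
  rw [ratioBT, sBT_fst_of_ne hne, sBT_snd_succ hij, ratioBT,
    ← mul_div_mul_right _ (1 + _) h']
  congr 1 <;> field_simp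

lemma ratioBT_sBT_succ {i j : ZMod 3} (hij : j = i + 1)
    (p : (ZMod 3 → ℂ) × (ZMod 3 → ℂ)) (h : okBT j p) :
    ratioBT i (sBT j p) =
      (p.1 i * p.1 j * (p.1 j + p.2 j) + p.2 i * (1 + p.1 j * p.2 j)) /
        (p.1 j + p.2 j + p.1 i * p.1 j * p.2 i * (1 + p.1 j * p.2 j)) := by
  have hne : j ≠ i := by simp [hij]
  obtain ⟨h', h''⟩ := h
  rw [ratioBT, sBT_fst_of_ne hne, sBT_snd_pred hij, ratioBT,
    ← mul_div_mul_right _ (1 + _) h'']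
  congr 1 <;> field_simp

/-- The braid relation for the component `f_{i+1}`. -/
lemma ratioBT_mul_ratioBT_succ {i j : ZMod 3} (hij : j = i + 1)
    (p : (ZMod 3 → ℂ) × (ZMod 3 → ℂ)) (ha : p.1 i ≠ 0) (h1 : okBT i p) (h2 : okBT j p)
    (h3 : okBT j (sBT i p)) :
    ratioBT i p * ratioBT i (sBT j (sBT i p)) = ratioBT i (sBT j p) := by
  have hne : i ≠ j := by simp [hij]
  rw [ratioBT_sBT_succ hij _ h3, ratioBT_sBT_succ hij _ h2, sBT_fst_self, sBT_snd_self,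
    sBT_fst_of_ne hne, sBT_snd_succ hij, ratioBT]
  obtain ⟨hD, hN⟩ := h1
  generalize p.1 i = x, p.1 j = y, p.2 i = u, p.2 j = v at *
  rw [show x⁻¹ * (y * x) * (y * x + v * ((x + u) / (1 + x * u))) +
      u * (1 + y * x * (v * ((x + u) / (1 + x * u)))) =
      x * y * (y + v) + u * (1 + y * v) by field_simp; ring,
    show y * x + v * ((x + u) / (1 + x * u)) +
      x⁻¹ * (y * x) * u * (1 + y * x * (v * ((x + u) / (1 + x * u)))) =
      (x + u) / (1 + x * u) * (y + v + x * y * u * (1 + y * v)) by field_simp; ring]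
  field_simp

/-- The braid relation for the component `fᵢ`. -/
lemma ratioBT_mul_ratioBT_pred {i j : ZMod 3} (hij : j = i + 1)
    (p : (ZMod 3 → ℂ) × (ZMod 3 → ℂ)) (ha : p.1 j ≠ 0) (h1 : okBT i p) (h2 : okBT j p)
    (h3 : okBT i (sBT j p)) :
    ratioBT j p * ratioBT j (sBT i (sBT j p)) = ratioBT j (sBT i p) := by
  have hne : j ≠ i := by simp [hij]
  rw [ratioBT_sBT_pred hij _ h3, ratioBT_sBT_pred hij _ h1, sBT_fst_self, sBT_snd_self,
    sBT_fst_of_ne hne, sBT_snd_pred hij, ratioBT]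
  obtain ⟨hD, hN⟩ := h2
  generalize p.1 i = x, p.1 j = y, p.2 i = u, p.2 j = v at *
  rw [show x * y * y⁻¹ * (1 + x * y * (u / ((y + v) / (1 + y * v)))) +
      v * (x * y + u / ((y + v) / (1 + y * v))) =
      (x * y * (1 + x * u) + v * (x + u)) / ((y + v) / (1 + y * v)) by field_simp; ring,
    show 1 + x * y * (u / ((y + v) / (1 + y * v))) +
      x * y * y⁻¹ * v * (x * y + u / ((y + v) / (1 + y * v))) =
      1 + x * u + x * y * v * (x + u) by field_simp; ring]
  field_simp

theorem sBT_braid (i : ZMod 3) (a f : ZMod 3 → ℂ)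
    (ha : ∀ j, a j ≠ 0)
    (h1 : okBT i (a, f)) (h2 : okBT (i + 1) (a, f))
    (h3 : okBT (i + 1) (sBT i (a, f)))
    (h4 : okBT i (sBT (i + 1) (a, f)))
    (h5 : okBT i (sBT (i + 1) (sBT i (a, f))))
    (h6 : okBT (i + 1) (sBT i (sBT (i + 1) (a, f)))) :
    sBT i (sBT (i + 1) (sBT i (a, f))) = sBT (i + 1) (sBT i (sBT (i + 1) (a, f))) := by
  obtain ⟨j, hij⟩ : ∃ j, j = i + 1 := ⟨_, rfl⟩
  rw [← hij] at h2 h3 h4 h6 ⊢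
  have hsucc := ratioBT_mul_ratioBT_succ hij (a, f) (ha i) h1 h2 h3
  have hpred := ratioBT_mul_ratioBT_pred hij (a, f) (ha j) h1 h2 h4
  have hne : i ≠ j := by simp [hij]
  have hcases (k : ZMod 3) : k = i ∨ k = j ∨ k = j + 1 := by
    subst hij; clear * -; decide +revert
  have hki : i = j + 1 + 1 := by subst hij; clear * -; decide +revert
  have hik : i ≠ j + 1 := by subst hij; clear * -; decide +revert
  have hjk : j ≠ j + 1 := by simp
  have hai := ha i
  have haj := ha j
  refine Prod.ext (funext fun k => ?_) (funext fun k => ?_) <;>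
    obtain rfl | rfl | rfl := hcases k
  · simp only [sBT_fst_self, sBT_fst_of_ne hne, sBT_fst_of_ne hne.symm]
    field_simp
  · simp only [sBT_fst_self, sBT_fst_of_ne hne, sBT_fst_of_ne hne.symm]
    field_simp
  · simp only [sBT_fst_self, sBT_fst_of_ne hne, sBT_fst_of_ne hne.symm, sBT_fst_of_ne hik,
      sBT_fst_of_ne hjk]
    field_simp
  · rw [sBT_snd_self, sBT_snd_pred hij, sBT_snd_self, sBT_snd_pred hij, sBT_snd_self,
      sBT_snd_pred hij, ← hpred, div_div]
  · rw [sBT_snd_succ hij, sBT_snd_self, sBT_snd_succ hij, sBT_snd_self, sBT_snd_succ hij,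
      sBT_snd_self, ← hsucc, mul_assoc]
  · rw [sBT_snd_pred hki, sBT_snd_succ rfl, sBT_snd_pred hki, sBT_snd_succ rfl,
      sBT_snd_pred hki, sBT_snd_succ rfl, ← hsucc, ← hpred]
    field_simp

end
end

section
/- Toeplitz determinant solutions of qP_IV for negative N (Theorem): let q, a₀ ∈ ℂ∖{0}, ν ∈ ℤ, and let Ḡ : ℤ × ℂ → ℂ satisfy, for all ν ∈ ℤ and c ∈ ℂ, the relations a₀²c²q^{2ν} Ḡ_ν(qc) + Ḡ_ν(c) = q² Ḡ_{ν-1}(c) and Ḡ_ν(qc) = Ḡ_{ν+1}(c) + c² Ḡ_{ν+1}(qc). For an integer M ≥ 1 set N = -M and define φ_N^μ(c) = det(Ḡ_{μ-i+j}(c))_{1≤i,j≤M}, with φ_0^μ(c) = 1. Define f₀(c) = a₀q^ν c² φ_{N+1}^ν(c)φ_N^ν(qc)/(φ_{N+1}^ν(qc)φ_N^ν(c)), f₁(c) = -(1/(a₀q^{ν+N-1})) φ_{N+1}^ν(qc)φ_N^{ν-1}(c)/(φ_{N+1}^ν(c)φ_N^{ν-1}(qc)), f₂(c) = -q^N φ_N^{ν-1}(qc)φ_N^ν(c)/(φ_N^ν(qc)φ_N^{ν-1}(c)).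 Then, at every c at which all the determinants appearing above (at arguments c, qc, q²c) are nonzero and all denominators below are nonzero, (f₀,f₁,f₂) satisfies the qP_IV system with a₂ = 1: f₀(qc) = q^{N+1} f₁(c)(1 + q^{-N}f₂(c) + a₀q^{ν-N}f₂(c)f₀(c))/(1 + a₀q^ν f₀(c) + q^{N+1}f₀(c)f₁(c)), f₁(qc) = (q^{1-ν}/a₀) f₂(c)(1 + a₀q^ν f₀(c) + q^{N+1}f₀(c)f₁(c))/(1 + (q^{N-ν+1}/a₀)f₁(c) + (q^{1-ν}/a₀)f₁(c)f₂(c)), f₂(qc) = a₀q^{ν-N} f₀(c)(1 + (q^{N-ν+1}/a₀)f₁(c) + (q^{1-ν}/a₀)f₁(c)f₂(c))/(1 + q^{-N}f₂(c) + a₀q^{ν-N}f₂(c)f₀(c)). -/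
noncomputable section

/-- The `M × M` Toeplitz determinant `det(Ḡ_{μ-i+j}(c))_{1≤i,j≤M}` built from the
negative-direction seed function `Ḡ`; for `N = -M ≤ 0` this is `φ_N^μ(c)`
(with `φ_0^μ(c) = 1`). -/
def phiBar (Gb : ℤ → ℂ → ℂ) (M : ℕ) (μ : ℤ) (c : ℂ) : ℂ :=
  Matrix.det (Matrix.of fun i j : Fin M => Gb (μ - ((i : ℕ) : ℤ) + ((j : ℕ) : ℤ)) c)

section ToeplitzDeterminants

open Matrix

theorem det_one_updateCol_updateCol {n R : Type*} [Fintype n] [DecidableEq n] [CommRing R]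
    {i j : n} (hij : i ≠ j) (x y : n → R) :
    (((1 : Matrix n n R).updateCol i x).updateCol j y).det = x i * y j - y i * x j := by
  have h : ((1 : Matrix n n R).updateCol i x).updateCol j y =
      1 + (of fun k (l : Fin 2) => (![x - Pi.single i 1, y - Pi.single j 1] l : n → R) k) *
        (of fun (l : Fin 2) k => (![Pi.single i 1, Pi.single j 1] l : n → R) k) := by
    ext k l
    simp only [updateCol_apply, Matrix.add_apply, mul_apply, Fin.sum_univ_two, of_apply, cons_val_zero,
      cons_val_one, Pi.sub_apply, one_apply, Pi.single_apply]
    by_cases h1 : l = j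
    · subst h1
      simp [hij.symm]
    · by_cases h2 : l = i
      · subst h2
        simp [hij]
      · simp [h1, h2]
  rw [h, det_one_add_mul_comm, det_fin_two]
  simp [mul_apply, Pi.single_apply, hij, hij.symm]

theorem det_mul_det_updateCol_updateCol {n R : Type*} [Fintype n] [DecidableEq n] [CommRing R]
    [IsDomain R] (A : Matrix n n R) {i j : n} (hij : i ≠ j) (a b : n → R) :
    A.det * ((A.updateCol i a).updateCol j b).det =
      (A.updateCol i a).det * (A.updateCol j b).det -
        (A.updateCol i b).det * (A.updateCol j a).det := by
  have key : ∀ {S : Type _} [CommRing S] [IsDomain S] (A : Matrix n n S) (a b : n → S),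
      A.det ≠ 0 → A.det * ((A.updateCol i a).updateCol j b).det =
        (A.updateCol i a).det * (A.updateCol j b).det -
          (A.updateCol i b).det * (A.updateCol j a).det := by
    intro S _ _ A a b hA
    have h : A * ((1 : Matrix n n S).updateCol i (cramer A a)).updateCol j (cramer A b) =
        (A.updateCol i (A.det • a)).updateCol j (A.det • b) := by
      rw [mul_updateCol, mul_updateCol, mul_one, mulVec_cramer, mulVec_cramer]
    have h2 := congrArg det h
    rw [det_mul, det_one_updateCol_updateCol hij, det_updateCol_smul, updateCol_comm _ hij,
      det_updateCol_smul, updateCol_comm _ hij.symm] at h2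
    simp only [cramer_apply] at h2
    exact mul_left_cancel₀ hA (by linear_combination -h2)
  let B : Matrix n n (Polynomial R) := (Polynomial.X : Polynomial R) • 1 + A.map Polynomial.C
  have hB : B.det ≠ 0 := by
    intro h0
    have := Polynomial.leadingCoeff_det_X_one_add_C A
    change B.det.leadingCoeff = 1 at this
    simp [h0] at this
  have hBA : (Polynomial.evalRingHom (0 : R)).mapMatrix B = A := by
    ext k l
    simp [B, Matrix.smul_apply]
  have h := congrArg (Polynomial.evalRingHom (0 : R))
    (key B (fun k => Polynomial.C (a k)) (fun k => Polynomial.C (b k)) hB)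
  simp only [map_mul, map_sub, RingHom.map_det] at h
  have hu : ∀ (D : Matrix n n (Polynomial R)) (k : n) (v : n → R),
      (Polynomial.evalRingHom (0 : R)).mapMatrix (D.updateCol k (fun l => Polynomial.C (v l))) =
      ((Polynomial.evalRingHom (0 : R)).mapMatrix D).updateCol k v := by
    intro D k v
    ext r s
    simp [updateCol_apply]
    split_ifs <;> simp
  simpa only [hu, hBA] using h

theorem det_eq_of_row_zero_eq_single {R : Type*} [CommRing R] {n : ℕ}
    (A : Matrix (Fin (n + 1)) (Fin (n + 1)) R) (j : Fin (n + 1)) (h : A 0 = Pi.single j 1) :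
    A.det = (-1) ^ (j : ℕ) * (A.submatrix Fin.succ j.succAbove).det := by
  rw [det_succ_row_zero, Finset.sum_eq_single j] <;> simp +contextual [h]

theorem det_mul_det_submatrix_succ_succ {R : Type*} [CommRing R] [IsDomain R] {n : ℕ}
    (A : Matrix (Fin (n + 2)) (Fin (n + 2)) R) :
    A.det * (A.submatrix (fun i : Fin n => i.succ.succ) fun j : Fin n => j.castSucc.succ).det =
      (A.submatrix Fin.succ Fin.succ).det * (A.submatrix (Fin.succAbove 1) Fin.castSucc).det -
      (A.submatrix Fin.succ Fin.castSucc).det * (A.submatrix (Fin.succAbove 1) Fin.succ).det := by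
  have h01 : (1 : Fin (n + 2)) ≠ 0 := by simp
  have h := det_mul_det_updateCol_updateCol Aᵀ h01
    (Pi.single (Fin.last (n + 1)) 1) (Pi.single 0 1)
  simp only [updateCol_transpose, det_transpose, ← adjugate_apply] at h
  simp only [adjugate_fin_succ_eq_det_submatrix] at h
  have h0 : ((A.updateRow 1 (Pi.single (Fin.last (n + 1)) 1)).submatrix (Fin.succAbove 0)
      (Fin.succAbove 0)) 0 = Pi.single (Fin.last n) 1 := by
    ext j
    simp [updateRow_apply, Pi.single_apply, Fin.ext_iff]
  have e : (((A.updateRow 1 (Pi.single (Fin.last (n + 1)) 1)).submatrix (Fin.succAbove 0)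
      (Fin.succAbove 0)).submatrix Fin.succ (Fin.last n).succAbove) =
      A.submatrix (fun i : Fin n => i.succ.succ) fun j : Fin n => j.castSucc.succ := by
    ext i j
    simp [updateRow_apply, Fin.ext_iff]
  rw [det_eq_of_row_zero_eq_single _ _ h0, e] at h
  have hs : ((-1 : R) ^ n) * (-1) ^ n = 1 := by rw [← mul_pow]; simp
  simp only [Fin.succAbove_zero, Fin.succAbove_last, Fin.val_zero, Fin.val_last, Fin.val_one,
    pow_add, pow_zero, pow_one, one_mul] at h
  refine mul_left_cancel₀ (pow_ne_zero n (neg_ne_zero.mpr one_ne_zero)) ?_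
  linear_combination h

theorem desnanot_jacobi {R : Type*} [CommRing R] [IsDomain R] {n : ℕ}
    (A : Matrix (Fin (n + 2)) (Fin (n + 2)) R) :
    A.det * (A.submatrix (fun i : Fin n => i.castSucc.succ) fun j : Fin n => j.castSucc.succ).det =
      (A.submatrix Fin.succ Fin.succ).det * (A.submatrix Fin.castSucc Fin.castSucc).det -
      (A.submatrix Fin.succ Fin.castSucc).det * (A.submatrix Fin.castSucc Fin.succ).det := by
  have hl : (Fin.last (n + 1) : Fin (n + 2)) ≠ 0 := by simp [Fin.ext_iff]
  have h := det_mul_det_updateCol_updateCol Aᵀ hl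
    (Pi.single (Fin.last (n + 1)) 1) (Pi.single 0 1)
  simp only [updateCol_transpose, det_transpose, ← adjugate_apply] at h
  simp only [adjugate_fin_succ_eq_det_submatrix] at h
  have e : ((A.updateRow (Fin.last (n + 1)) (Pi.single (Fin.last (n + 1)) 1)).submatrix
      (Fin.succAbove 0) (Fin.succAbove 0)) =
      (A.submatrix Fin.succ Fin.succ).updateRow (Fin.last n) (Pi.single (Fin.last n) 1) := by
    ext i j
    simp only [Fin.succAbove_zero, submatrix_apply, updateRow_apply, Pi.single_apply, Fin.ext_iff,
      Fin.val_succ, Fin.val_last, Nat.add_right_cancel_iff]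
  rw [e, ← adjugate_apply, adjugate_fin_succ_eq_det_submatrix, submatrix_submatrix] at h
  have hs : ((-1 : R) ^ n) * (-1) ^ n = 1 := by rw [← mul_pow]; simp
  simp only [Fin.succAbove_zero, Fin.succAbove_last, Fin.val_zero, Fin.val_last,
    pow_add, pow_zero, pow_one, one_mul, mul_one, mul_neg, neg_mul, neg_neg, hs] at h
  have e2 : A.submatrix (Fin.succ ∘ Fin.castSucc) (Fin.succ ∘ Fin.castSucc) =
      A.submatrix (fun i : Fin n => i.castSucc.succ) fun j : Fin n => j.castSucc.succ := rfl
  rw [← e2]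
  linear_combination h -
    (A.submatrix Fin.succ Fin.castSucc).det * (A.submatrix Fin.castSucc Fin.succ).det * hs

theorem det_rowPivot {K : Type*} [Field K] {n : ℕ} (r : ℕ → Fin (n + 1) → K) (a : K) {b : K}
    (hb : b ≠ 0) :
    (of fun i j : Fin (n + 1) => (Fin.cases (r 0 j)
      (fun i' : Fin n => a * r i' j + b * r (i' + 1) j) i : K)).det =
      b ^ n * (of fun i j : Fin (n + 1) => r i j).det := by
  have h1 : (of fun i j : Fin (n + 1) => r i j).det =
      (of fun i j : Fin (n + 1) => (Fin.cases 1 (fun _ => b⁻¹) i : K) *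
        (of fun i j : Fin (n + 1) => (Fin.cases (r 0 j)
          (fun i' : Fin n => a * r i' j + b * r (i' + 1) j) i : K)) i j).det := by
    refine det_eq_of_forall_row_eq_smul_add_pred (fun _ => -(a / b)) (fun j => by simp) ?_
    intro i j
    simp
    field_simp
    ring
  rw [h1, det_mul_column, Fin.prod_univ_succ]
  simp [hb]

theorem det_colPivot {K : Type*} [Field K] {n : ℕ} (r : ℕ → Fin (n + 1) → K) (a : K) {b : K}
    (hb : b ≠ 0) :
    (of fun j i : Fin (n + 1) => (Fin.cases (r 0 j)
      (fun i' : Fin n => a * r i' j + b * r (i' + 1) j) i : K)).det =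
      b ^ n * (of fun j i : Fin (n + 1) => r i j).det := by
  rw [← det_transpose, ← det_transpose (of fun j i : Fin (n + 1) => r i j)]
  exact det_rowPivot r a hb

theorem det_geometricRow {K : Type*} [Field K] {n : ℕ} (g : Fin n → ℕ → K) {c d t : K}
    (ht : c * t + d = 0) :
    c ^ n * (of fun i j : Fin (n + 1) => (Fin.cases (t ^ (j : ℕ))
      (fun i' : Fin n => g i' j) i : K)).det =
      (of fun i j : Fin n => c * g i (j + 1) + d * g i j).det := by
  set A : Matrix (Fin (n + 1)) (Fin (n + 1)) K := of fun i j : Fin (n + 1) =>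
    (Fin.cases (t ^ (j : ℕ)) (fun i' : Fin n => g i' j) i : K) with hA
  have h1 : A.det = (of fun i j : Fin (n + 1) => (Fin.cases (A i 0)
      (fun j' : Fin n => A i j'.succ - t * A i j'.castSucc) j : K)).det :=
    det_eq_of_forall_col_eq_smul_add_pred (fun _ => t) (fun i => by simp) (fun i j => by simp)
  rw [h1, det_eq_of_row_zero_eq_single _ 0, Fin.val_zero, pow_zero, one_mul]
  · refine Eq.trans (by rw [det_smul, Fintype.card_fin]) (congrArg det (?_ : c • _ = _))
    ext i j
    simp [hA]
    linear_combination -(g i j) * ht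
  · ext j
    refine Fin.cases ?_ (fun j => ?_) j
    · simp [hA]
    · simp [hA, pow_succ, mul_comm]

/-- The Toeplitz determinant `det (f (μ + i - j))` of size `n`. -/
def toeplitzDet {K : Type*} [CommRing K] (f : ℤ → K) (n : ℕ) (μ : ℤ) : K :=
  (of fun i j : Fin n => f (μ + (i : ℕ) - (j : ℕ))).det

/-- The first-order difference operator `f ↦ a f(· - 1) + b f`. -/
def diffOp {K : Type*} [CommRing K] (a b : K) (f : ℤ → K) : ℤ → K :=
  fun μ => a * f (μ - 1) + b * f μ

theorem toeplitzDet_diffOp_mul_toeplitzDet_diffOp {K : Type*} [Field K] (y : ℤ → K) (a d : K)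
    {b c : K} (hb : b ≠ 0) (hc : c ≠ 0) (m : ℕ) (ν : ℤ) :
    toeplitzDet (diffOp c d y) (m + 1) ν * toeplitzDet (diffOp a b y) m ν =
      c * toeplitzDet (diffOp c d (diffOp a b y)) m (ν + 1) * toeplitzDet y (m + 1) (ν - 1) +
      d * toeplitzDet (diffOp c d (diffOp a b y)) m ν * toeplitzDet y (m + 1) ν := by
  have ht : c * (-d / c) + d = 0 := by field_simp; ring
  set t : K := -d / c with ht'
  let A : Matrix (Fin (m + 2)) (Fin (m + 2)) K := of fun i j =>
    (Fin.cases (t ^ (j : ℕ)) (fun i' : Fin (m + 1) => (Fin.cases (y (ν - (j : ℕ)))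
      (fun i'' : Fin m => diffOp a b y (ν + (i'' : ℕ) + 1 - (j : ℕ))) i' : K)) i : K)
  have h := det_mul_det_submatrix_succ_succ A
  have e1 : (A.submatrix (fun i : Fin m => i.succ.succ) fun j : Fin m => j.castSucc.succ).det =
      toeplitzDet (diffOp a b y) m ν := by
    unfold toeplitzDet
    congr 1
    ext i j
    simp only [A, submatrix_apply, of_apply, Fin.cases_succ, Fin.val_succ, Fin.val_castSucc]
    congr 1
    push_cast
    ring
  have e2 : (A.submatrix Fin.succ Fin.succ).det = b ^ m * toeplitzDet y (m + 1) (ν - 1) := by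
    refine Eq.trans ?_ ((det_rowPivot (fun i (j : Fin (m + 1)) => y (ν - 1 + i - (j : ℕ))) a hb).trans ?_)
    · congr 1
      ext i j
      refine Fin.cases ?_ (fun i => ?_) i
      · change y (ν - (j.succ : ℕ)) = y (ν - 1 + (0 : ℕ) - (j : ℕ))
        congr 1
        push_cast [Fin.val_succ]
        ring
      · change diffOp a b y (ν + (i : ℕ) + 1 - (j.succ : ℕ)) =
          a * y (ν - 1 + (i : ℕ) - (j : ℕ)) + b * y (ν - 1 + ((i : ℕ) + 1 : ℕ) - (j : ℕ))
        simp only [diffOp, Fin.val_succ]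
        push_cast
        ring_nf
    · rfl
  have e3 : (A.submatrix Fin.succ Fin.castSucc).det = b ^ m * toeplitzDet y (m + 1) ν := by
    refine Eq.trans ?_ ((det_rowPivot (fun i (j : Fin (m + 1)) => y (ν + i - (j : ℕ))) a hb).trans ?_)
    · congr 1
      ext i j
      refine Fin.cases ?_ (fun i => ?_) i
      · change y (ν - (j.castSucc : ℕ)) = y (ν + (0 : ℕ) - (j : ℕ))
        simp
      · simp [A, diffOp]
        ring_nf
    · rfl
  have e4 : c ^ m * (A.submatrix (Fin.succAbove 1) Fin.castSucc).det =
      toeplitzDet (diffOp c d (diffOp a b y)) m (ν + 1) := by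
    refine Eq.trans ?_ ((det_geometricRow
      (fun (i : Fin m) j => diffOp a b y (ν + (i : ℕ) + 1 - j)) ht).trans ?_)
    · congr 2
      ext i j
      refine Fin.cases ?_ (fun i => ?_) i
      · simp [A]
      · simp [A]
    · unfold toeplitzDet
      congr 1
      ext i j
      simp [diffOp]
      ring_nf
  have e5 : c ^ m * (A.submatrix (Fin.succAbove 1) Fin.succ).det =
      t * toeplitzDet (diffOp c d (diffOp a b y)) m ν := by
    have e : A.submatrix (Fin.succAbove 1) Fin.succ = of fun i j => (Fin.cases t (fun _ => 1) i : K) *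
        (of fun i j : Fin (m + 1) => (Fin.cases (t ^ (j : ℕ))
          (fun i' : Fin m => diffOp a b y (ν + (i' : ℕ) - (j : ℕ))) i : K)) i j := by
      ext i j
      refine Fin.cases ?_ (fun i => ?_) i
      · simp [A, pow_succ, mul_comm]
      · simp [A]
    rw [e, det_mul_column, Fin.prod_univ_succ]
    simp only [Fin.cases_zero, Fin.cases_succ, Finset.prod_const_one, mul_one]
    rw [mul_left_comm, det_geometricRow
      (fun (i : Fin m) j => diffOp a b y (ν + (i : ℕ) - j)) ht]
    unfold toeplitzDet
    congr 2
    ext i j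
    simp only [diffOp, of_apply]
    push_cast
    ring_nf
  have e6 : c ^ (m + 1) * A.det = b ^ m * toeplitzDet (diffOp c d y) (m + 1) ν := by
    refine Eq.trans (det_geometricRow (fun (i : Fin (m + 1)) j => (Fin.cases (y (ν - j))
      (fun i'' : Fin m => diffOp a b y (ν + (i'' : ℕ) + 1 - j)) i : K)) ht) ?_
    refine Eq.trans ?_ ((det_rowPivot (fun i (j : Fin (m + 1)) => diffOp c d y (ν + i - (j : ℕ))) a hb).trans ?_)
    · congr 1
      ext i j
      refine Fin.cases ?_ (fun i => ?_) i
      · simp only [diffOp, of_apply, Fin.cases_zero]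
        push_cast
        ring_nf
      · simp [diffOp]
        ring_nf
    · rfl
  rw [e1, e2, e3] at h
  have hbm : b ^ m ≠ 0 := pow_ne_zero _ hb
  refine mul_left_cancel₀ hbm ?_
  linear_combination (-toeplitzDet (diffOp a b y) m ν) * e6 + c ^ (m + 1) * h +
    c * b ^ m * toeplitzDet y (m + 1) (ν - 1) * e4 - c * b ^ m * toeplitzDet y (m + 1) ν * e5
    - b ^ m * toeplitzDet y (m + 1) ν * toeplitzDet (diffOp c d (diffOp a b y)) m ν * ht

theorem mul_toeplitzDet_mul_toeplitzDet_diffOp {K : Type*} [Field K] (y : ℤ → K) (a d : K)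
    {b c : K} (hb : b ≠ 0) (hc : c ≠ 0) (m : ℕ) (μ : ℤ) :
    b * c * (toeplitzDet y (m + 2) μ * toeplitzDet (diffOp c d (diffOp a b y)) m (μ + 1)) =
      toeplitzDet (diffOp c d (diffOp a b y)) (m + 1) (μ + 1) * toeplitzDet y (m + 1) μ -
      toeplitzDet (diffOp a b y) (m + 1) (μ + 1) * toeplitzDet (diffOp c d y) (m + 1) μ := by
  let r (n : ℕ) : ℕ → Fin (n + 1) → K := fun i j =>
    (Fin.cases (y (μ + i)) (fun j' : Fin n => d * y (μ + i - (j' : ℕ)) +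
      c * y (μ + i - ((j' : ℕ) + 1 : ℕ))) j : K)
  let A (n : ℕ) : Matrix (Fin (n + 1)) (Fin (n + 1)) K := of fun i j =>
    (Fin.cases (r n 0 j) (fun i' : Fin n => a * r n i' j + b * r n (i' + 1) j) i : K)
  have hA (n : ℕ) : (A n).det = b ^ n * (c ^ n * toeplitzDet y (n + 1) μ) := by
    refine (det_rowPivot (r n) a hb).trans ?_
    congr 1
    refine Eq.trans ?_ (det_colPivot (fun j (i : Fin (n + 1)) => y (μ + (i : ℕ) - j)) d hc)
    congr 1
    ext i j
    refine Fin.cases ?_ (fun j => ?_) j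
    · simp [r]
    · simp [r]
  have h := desnanot_jacobi (A (m + 1))
  have e1 : ((A (m + 1)).submatrix (fun i : Fin m => i.castSucc.succ)
      fun j : Fin m => j.castSucc.succ).det =
      toeplitzDet (diffOp c d (diffOp a b y)) m (μ + 1) := by
    unfold toeplitzDet
    congr 1
    ext i j
    simp [A, r, diffOp]
    ring_nf
  have e2 : ((A (m + 1)).submatrix Fin.succ Fin.succ).det =
      toeplitzDet (diffOp c d (diffOp a b y)) (m + 1) (μ + 1) := by
    unfold toeplitzDet
    congr 1
    ext i j
    simp [A, r, diffOp]
    ring_nf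
  have e3 : (A (m + 1)).submatrix Fin.castSucc Fin.castSucc = A m := by
    ext i j
    refine Fin.cases ?_ (fun i => ?_) i <;> refine Fin.cases ?_ (fun j => ?_) j <;>
      simp [A, r]
  have e4 : ((A (m + 1)).submatrix Fin.succ Fin.castSucc).det =
      c ^ m * toeplitzDet (diffOp a b y) (m + 1) (μ + 1) := by
    refine Eq.trans ?_ (det_colPivot
      (fun j (i : Fin (m + 1)) => diffOp a b y (μ + 1 + (i : ℕ) - j)) d hc)
    congr 1
    ext i j
    refine Fin.cases ?_ (fun j => ?_) j
    · simp [A, r, diffOp]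
      ring_nf
    · simp [A, r, diffOp]
      ring_nf
  have e5 : ((A (m + 1)).submatrix Fin.castSucc Fin.succ).det =
      b ^ m * toeplitzDet (diffOp c d y) (m + 1) μ := by
    refine Eq.trans ?_ (det_rowPivot
      (fun i (j : Fin (m + 1)) => diffOp c d y (μ + i - (j : ℕ))) a hb)
    congr 1
    ext i j
    refine Fin.cases ?_ (fun i => ?_) i
    · simp [A, r, diffOp]
      ring_nf
    · simp [A, r, diffOp]
      ring_nf
  rw [e1, e2, e3, e4, e5, hA, hA] at h
  refine mul_left_cancel₀ (mul_ne_zero (pow_ne_zero m hb) (pow_ne_zero m hc)) ?_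
  linear_combination h

theorem toeplitzDet_comp_sub {K : Type*} [CommRing K] (f : ℤ → K) (s : ℤ) (n : ℕ) (μ : ℤ) :
    toeplitzDet (fun k => f (s - k)) n μ = toeplitzDet f n (s - μ) := by
  unfold toeplitzDet
  rw [← det_transpose]
  congr 1
  ext i j
  simp only [transpose_apply, of_apply]
  congr 1
  ring

theorem toeplitzDet_diffOp_diffOp_mul_toeplitzDet {K : Type*} [Field K] (y : ℤ → K)
    {a b c d : K} (ha : a ≠ 0) (hb : b ≠ 0) (hc : c ≠ 0) (hd : d ≠ 0) (m : ℕ) (μ : ℤ) :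
    (a * d - b * c) * (toeplitzDet (diffOp c d (diffOp a b y)) (m + 1) (μ + 1) *
        toeplitzDet y (m + 1) μ) =
      a * d * (toeplitzDet (diffOp a b y) (m + 1) (μ + 1) *
        toeplitzDet (diffOp c d y) (m + 1) μ) -
      b * c * (toeplitzDet (diffOp a b y) (m + 1) μ *
        toeplitzDet (diffOp c d y) (m + 1) (μ + 1)) := by
  have h1 := mul_toeplitzDet_mul_toeplitzDet_diffOp y a d hb hc m μ
  have h2 := mul_toeplitzDet_mul_toeplitzDet_diffOp (fun k => y (0 - k)) b c ha hd m (-μ)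
  have e (p r : K) (f : ℤ → K) (s : ℤ) :
      diffOp p r (fun k => f (s - k)) = fun k => diffOp r p f (s + 1 - k) := by
    funext k
    simp only [diffOp]
    rw [show s - (k - 1) = s + 1 - k by ring, show s + 1 - k - 1 = s - k by ring]
    ring
  simp only [e, toeplitzDet_comp_sub] at h2
  rw [show (0 : ℤ) - -μ = μ by ring, show (0 : ℤ) + 1 + 1 - (-μ + 1) = μ + 1 by ring,
    show (0 : ℤ) + 1 - (-μ + 1) = μ by ring, show (0 : ℤ) + 1 - -μ = μ + 1 by ring] at h2
  linear_combination b * c * h2 - a * d * h1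

theorem toeplitzDet_mul_zpow {K : Type*} [Field K] (f : ℤ → K) (κ : K) {q : K} (hq : q ≠ 0)
    (n : ℕ) (μ : ℤ) :
    toeplitzDet (fun k => κ * q ^ k * f k) n μ = (κ * q ^ μ) ^ n * toeplitzDet f n μ := by
  have h : toeplitzDet (fun k => κ * q ^ k * f k) n μ =
      (of fun i j : Fin n => (q ^ (j : ℕ))⁻¹ * (of fun i j : Fin n => (κ * q ^ μ * q ^ (i : ℕ)) *
        (of fun i j : Fin n => f (μ + (i : ℕ) - (j : ℕ))) i j) i j).det := by
    unfold toeplitzDet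
    congr 1
    ext i j
    simp [zpow_sub₀ hq, zpow_add₀ hq]
    ring
  rw [h, det_mul_row, det_mul_column, Finset.prod_mul_distrib, Finset.prod_inv_distrib,
    Finset.prod_const, Finset.card_univ, Fintype.card_fin]
  have hp : ∏ i : Fin n, q ^ (i : ℕ) ≠ 0 := Finset.prod_ne_zero_iff.mpr fun i _ => pow_ne_zero _ hq
  unfold toeplitzDet
  field_simp

theorem diffOp_comm {K : Type*} [CommRing K] (a b c d : K) (f : ℤ → K) :
    diffOp a b (diffOp c d f) = diffOp c d (diffOp a b f) := by
  funext k
  simp only [diffOp]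
  ring

/-- The Toeplitz determinants of three consecutive members `x`, `y`, `z` of a `q`-chain satisfy
four bilinear identities. -/
theorem toeplitzDet_bilinear {K : Type*} [Field K] {q c A : K} (hq : q ≠ 0) (hc : c ≠ 0)
    (hA : A ≠ 0) {x y z : ℤ → K} (hyx : diffOp 1 (-c ^ 2) y = x)
    (hxy : diffOp (q ^ 2) (-1) x = fun k => A * (q ^ 2) ^ k * y k)
    (hyz : diffOp (q ^ 2) (-1) y = fun k => A * q ^ 2 * (q ^ 2) ^ k * z k) (m : ℕ) (ν : ℤ) :
    A * (q ^ 2) ^ ν * (toeplitzDet y (m + 1) ν * toeplitzDet x m ν) =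
        (q ^ 2) ^ (m + 1) * (toeplitzDet y m (ν + 1) * toeplitzDet x (m + 1) (ν - 1)) -
          toeplitzDet y m ν * toeplitzDet x (m + 1) ν ∧
      A * (q ^ 2) ^ ν * (q ^ 2) ^ (m + 1) * (toeplitzDet z (m + 1) ν * toeplitzDet x m ν) =
        (q ^ 2) ^ (m + 1) * (toeplitzDet y m (ν + 1) * toeplitzDet y (m + 1) (ν - 1)) -
          toeplitzDet y m ν * toeplitzDet y (m + 1) ν ∧
      (q ^ 2) ^ (m + 1) * (toeplitzDet z m ν * toeplitzDet x (m + 1) ν) =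
        (q ^ 2) ^ (m + 1) * (toeplitzDet y m (ν + 1) * toeplitzDet y (m + 1) (ν - 1)) -
          q ^ 2 * c ^ 2 * (toeplitzDet y m ν * toeplitzDet y (m + 1) ν) ∧
      toeplitzDet z (m + 1) (ν - 1) * toeplitzDet x (m + 1) ν -
          q ^ 2 * c ^ 2 * (q ^ 2) ^ (m + 1) *
            (toeplitzDet z (m + 1) ν * toeplitzDet x (m + 1) (ν - 1)) =
        (1 - q ^ 2 * c ^ 2) * (toeplitzDet y (m + 1) ν * toeplitzDet y (m + 1) (ν - 1)) := by
  have hq2 : q ^ 2 ≠ 0 := pow_ne_zero 2 hq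
  have hc2 : -c ^ 2 ≠ 0 := neg_ne_zero.mpr (pow_ne_zero 2 hc)
  have h1 := toeplitzDet_diffOp_mul_toeplitzDet_diffOp x 0 (-1) one_ne_zero hq2 m ν
  have h2 := toeplitzDet_diffOp_mul_toeplitzDet_diffOp y 1 (-1) hc2 hq2 m ν
  have h3 := toeplitzDet_diffOp_mul_toeplitzDet_diffOp y (q ^ 2) (-c ^ 2)
    (neg_ne_zero.mpr one_ne_zero) one_ne_zero m ν
  have h4 := toeplitzDet_diffOp_diffOp_mul_toeplitzDet y one_ne_zero hc2 hq2
    (neg_ne_zero.mpr one_ne_zero) m (ν - 1)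
  rw [show diffOp 0 1 x = x by funext k; simp [diffOp]] at h1
  rw [diffOp_comm 1 (-c ^ 2)] at h3
  simp only [hyx, hxy, hyz, toeplitzDet_mul_zpow _ _ hq2, sub_add_cancel, zpow_add_one₀ hq2,
    zpow_sub_one₀ hq2] at h1 h2 h3 h4
  set B := A * (q ^ 2) ^ ν with hB
  have hB0 : B ≠ 0 := mul_ne_zero hA (zpow_ne_zero _ hq2)
  have e1 : A * q ^ 2 * (q ^ 2) ^ ν = B * q ^ 2 := by rw [hB]; ring
  have e2 : A * ((q ^ 2) ^ ν * q ^ 2) = B * q ^ 2 := by rw [hB]; ring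
  have e3 : A * q ^ 2 * ((q ^ 2) ^ ν * (q ^ 2)⁻¹) = B := by rw [hB]; field_simp
  simp only [e1, e2, e3, mul_pow B] at h1 h2 h3 h4
  refine ⟨?_, ?_, ?_, ?_⟩
  · refine mul_left_cancel₀ (pow_ne_zero m hB0) ?_
    linear_combination h1
  · refine mul_left_cancel₀ (pow_ne_zero m hB0) ?_
    linear_combination h2
  · refine mul_left_cancel₀ (pow_ne_zero m hB0) ?_
    linear_combination q ^ 2 * h3
  · refine mul_left_cancel₀ (pow_ne_zero (m + 1) hB0) ?_
    linear_combination h4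

theorem qPIV_of_bilinear {K : Type*} [Field K] {q c a u v P₀ P₁ P₂ Q₀ Q₁ Q₂ R₀ R₁ R₂ W : K}
    (hq : q ≠ 0) (hc : c ≠ 0) (ha : a ≠ 0) (hu : u ≠ 0) (hv : v ≠ 0)
    (hP₀ : P₀ ≠ 0) (hP₁ : P₁ ≠ 0) (hP₂ : P₂ ≠ 0) (hQ₀ : Q₀ ≠ 0) (hQ₁ : Q₁ ≠ 0) (hQ₂ : Q₂ ≠ 0)
    (hR₀ : R₀ ≠ 0) (hR₁ : R₁ ≠ 0) (hR₂ : R₂ ≠ 0)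
    (h1 : (a * c * u) ^ 2 * (Q₁ * P₀) = v ^ 2 * (W * R₀) - P₁ * Q₀)
    (h2 : (a * c * u) ^ 2 * v ^ 2 * (Q₂ * P₀) = v ^ 2 * (W * R₁) - P₁ * Q₁)
    (h3 : v ^ 2 * (P₂ * Q₀) = v ^ 2 * (W * R₁) - q ^ 2 * c ^ 2 * (P₁ * Q₁))
    (h4 : R₂ * Q₀ - q ^ 2 * c ^ 2 * v ^ 2 * (Q₂ * R₀) = (1 - q ^ 2 * c ^ 2) * (Q₁ * R₁))
    {f₀ f₁ f₂ g₀ g₁ g₂ : K}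
    (hf₀ : f₀ = a * u * c ^ 2 * (P₀ * Q₁) / (P₁ * Q₀))
    (hf₁ : f₁ = -(1 / (a * (u / v / q))) * (P₁ * R₀) / (P₀ * R₁))
    (hf₂ : f₂ = -v⁻¹ * (R₁ * Q₀) / (Q₁ * R₀))
    (hg₀ : g₀ = a * u * (q * c) ^ 2 * (P₁ * Q₂) / (P₂ * Q₁))
    (hg₁ : g₁ = -(1 / (a * (u / v / q))) * (P₂ * R₁) / (P₁ * R₂))
    (hg₂ : g₂ = -v⁻¹ * (R₂ * Q₁) / (Q₂ * R₁)) :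
    g₀ = q / v * f₁ * (1 + v * f₂ + a * (u * v) * f₂ * f₀) /
        (1 + a * u * f₀ + q / v * f₀ * f₁) ∧
      g₁ = q / u / a * f₂ * (1 + a * u * f₀ + q / v * f₀ * f₁) /
        (1 + q / (u * v) / a * f₁ + q / u / a * f₁ * f₂) ∧
      g₂ = a * (u * v) * f₀ * (1 + q / (u * v) / a * f₁ + q / u / a * f₁ * f₂) /
        (1 + v * f₂ + a * (u * v) * f₂ * f₀) := by
  have hD₀ : 1 + a * u * f₀ + q / v * f₀ * f₁ = v ^ 2 * P₂ * R₀ / (P₁ * R₁) := by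
    rw [hf₀, hf₁]
    field_simp
    linear_combination R₁ * h1 - R₀ * h3
  have hD₁ : 1 + q / (u * v) / a * f₁ + q / u / a * f₁ * f₂ = R₂ * Q₀ / (Q₁ * R₁) := by
    rw [hf₁, hf₂]
    field_simp
    refine mul_left_cancel₀ (pow_ne_zero 2 hc) ?_
    linear_combination q ^ 2 * c ^ 2 * (R₁ * h1 - R₀ * h2) - (a * c * u) ^ 2 * P₀ * h4
  have hD₂ : 1 + v * f₂ + a * (u * v) * f₂ * f₀ =
      -((a * c * u) ^ 2 * v ^ 2 * Q₂ * P₀) / (P₁ * Q₁) := by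
    rw [hf₀, hf₂]
    field_simp
    linear_combination R₀ * h2 - R₁ * h1
  rw [hD₀, hD₁, hD₂, hf₀, hf₁, hf₂, hg₀, hg₁, hg₂]
  refine ⟨?_, ?_, ?_⟩ <;> field_simp

theorem phiBar_eq_toeplitzDet (Gb : ℤ → ℂ → ℂ) (n : ℕ) (μ : ℤ) (c : ℂ) :
    phiBar Gb n μ c = toeplitzDet (fun k => Gb k c) n μ := by
  unfold phiBar toeplitzDet
  rw [← det_transpose]
  congr 1
  ext i j
  simp only [transpose_apply, of_apply]
  congr 1
  ring

end ToeplitzDeterminants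

/-- Toeplitz determinant solutions of qP_IV for negative `N = -M` (with `a₂ = 1`). -/
theorem qPIV_Toeplitz_solution_neg (q a₀ : ℂ) (hq : q ≠ 0) (ha : a₀ ≠ 0) (ν : ℤ)
    (M : ℕ) (hM : 1 ≤ M)
    (Gb : ℤ → ℂ → ℂ)
    (hc1 : ∀ (μ : ℤ) (c : ℂ),
      a₀ ^ 2 * c ^ 2 * q ^ (2 * μ) * Gb μ (q * c) + Gb μ c = q ^ 2 * Gb (μ - 1) c)
    (hc2 : ∀ (μ : ℤ) (c : ℂ), Gb μ (q * c) = Gb (μ + 1) c + c ^ 2 * Gb (μ + 1) (q * c))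
    (f₀ f₁ f₂ : ℂ → ℂ)
    (hf0 : ∀ c, f₀ c = a₀ * q ^ ν * c ^ 2 * (phiBar Gb (M - 1) ν c * phiBar Gb M ν (q * c)) /
        (phiBar Gb (M - 1) ν (q * c) * phiBar Gb M ν c))
    (hf1 : ∀ c, f₁ c = -(1 / (a₀ * q ^ (ν - (M : ℤ) - 1))) *
        (phiBar Gb (M - 1) ν (q * c) * phiBar Gb M (ν - 1) c) /
        (phiBar Gb (M - 1) ν c * phiBar Gb M (ν - 1) (q * c)))
    (hf2 : ∀ c, f₂ c = -q ^ (-(M : ℤ)) * (phiBar Gb M (ν - 1) (q * c) * phiBar Gb M ν c) /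
        (phiBar Gb M ν (q * c) * phiBar Gb M (ν - 1) c)) :
    ∀ c : ℂ,
      (∀ x ∈ ({c, q * c, q * (q * c)} : Set ℂ),
        phiBar Gb M ν x ≠ 0 ∧ phiBar Gb (M - 1) ν x ≠ 0 ∧ phiBar Gb M (ν - 1) x ≠ 0) →
      1 + a₀ * q ^ ν * f₀ c + q ^ (1 - (M : ℤ)) * f₀ c * f₁ c ≠ 0 →
      1 + q ^ (-(M : ℤ) - ν + 1) / a₀ * f₁ c + q ^ (1 - ν) / a₀ * f₁ c * f₂ c ≠ 0 →
      1 + q ^ (M : ℤ) * f₂ c + a₀ * q ^ (ν + (M : ℤ)) * f₂ c * f₀ c ≠ 0 →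
      f₀ (q * c) = q ^ (1 - (M : ℤ)) * f₁ c *
          (1 + q ^ (M : ℤ) * f₂ c + a₀ * q ^ (ν + (M : ℤ)) * f₂ c * f₀ c) /
          (1 + a₀ * q ^ ν * f₀ c + q ^ (1 - (M : ℤ)) * f₀ c * f₁ c) ∧
      f₁ (q * c) = q ^ (1 - ν) / a₀ * f₂ c *
          (1 + a₀ * q ^ ν * f₀ c + q ^ (1 - (M : ℤ)) * f₀ c * f₁ c) /
          (1 + q ^ (-(M : ℤ) - ν + 1) / a₀ * f₁ c + q ^ (1 - ν) / a₀ * f₁ c * f₂ c) ∧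
      f₂ (q * c) = a₀ * q ^ (ν + (M : ℤ)) * f₀ c *
          (1 + q ^ (-(M : ℤ) - ν + 1) / a₀ * f₁ c + q ^ (1 - ν) / a₀ * f₁ c * f₂ c) /
          (1 + q ^ (M : ℤ) * f₂ c + a₀ * q ^ (ν + (M : ℤ)) * f₂ c * f₀ c) := by
  intro c hne hd₀ hd₁ hd₂
  obtain ⟨m, rfl⟩ : ∃ m, M = m + 1 := ⟨M - 1, by omega⟩
  simp only [Nat.add_sub_cancel] at hf0 hf1 hf2 hne
  obtain ⟨hQ₀, hP₀, hR₀⟩ := hne c (by simp)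
  obtain ⟨hQ₁, hP₁, hR₁⟩ := hne (q * c) (by simp)
  obtain ⟨hQ₂, hP₂, hR₂⟩ := hne (q * (q * c)) (by simp)
  have hc : c ≠ 0 := by
    rintro rfl
    rw [mul_zero] at hQ₁ hR₁
    refine hd₂ ?_
    rw [hf0, hf2, mul_zero, mul_comm (phiBar Gb (m + 1) (ν - 1) 0), mul_div_assoc,
      div_self (mul_ne_zero hQ₁ hR₁), zpow_neg]
    have := zpow_ne_zero ((m + 1 : ℕ) : ℤ) hq
    field_simp
    ring
  have hq2 (μ : ℤ) : q ^ (2 * μ) = (q ^ 2) ^ μ := by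
    rw [zpow_mul]
    norm_cast
  obtain ⟨h1, h2, h3, h4⟩ := toeplitzDet_bilinear (x := fun k => Gb k c)
    (y := fun k => Gb k (q * c)) (z := fun k => Gb k (q * (q * c))) (A := a₀ ^ 2 * c ^ 2) hq hc
    (mul_ne_zero (pow_ne_zero 2 ha) (pow_ne_zero 2 hc))
    (by
      funext k
      have := hc2 (k - 1) c
      rw [sub_add_cancel] at this
      simp only [diffOp]
      linear_combination this)
    (by
      funext k
      simp only [diffOp, ← hq2]
      linear_combination -hc1 k c)
    (by
      funext k
      simp only [diffOp, ← hq2]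
      linear_combination -hc1 k (q * c)) m ν
  simp only [← phiBar_eq_toeplitzDet] at h1 h2 h3 h4
  have hu : (q ^ 2) ^ ν = (q ^ ν) ^ 2 := by
    rw [← zpow_natCast, ← zpow_natCast, ← zpow_mul, ← zpow_mul, mul_comm]
  have hv : (q ^ 2) ^ (m + 1) = (q ^ ((m + 1 : ℕ) : ℤ)) ^ 2 := by
    rw [zpow_natCast, ← pow_mul, ← pow_mul, mul_comm]
  rw [hu] at h1 h2
  rw [hv] at h1 h2 h3 h4
  have e1 : q ^ (ν - ((m + 1 : ℕ) : ℤ) - 1) = q ^ ν / q ^ ((m + 1 : ℕ) : ℤ) / q := by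
    rw [zpow_sub₀ hq, zpow_sub₀ hq, zpow_one]
  have e2 : q ^ (1 - ((m + 1 : ℕ) : ℤ)) = q / q ^ ((m + 1 : ℕ) : ℤ) := by
    rw [zpow_sub₀ hq, zpow_one]
  have e3 : q ^ (-((m + 1 : ℕ) : ℤ) - ν + 1) = q / (q ^ ν * q ^ ((m + 1 : ℕ) : ℤ)) := by
    rw [← zpow_add₀ hq, show -((m + 1 : ℕ) : ℤ) - ν + 1 = 1 - (ν + ((m + 1 : ℕ) : ℤ)) by ring,
      zpow_sub₀ hq, zpow_one]
  have e4 : q ^ (1 - ν) = q / q ^ ν := by rw [zpow_sub₀ hq, zpow_one]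
  have e5 : q ^ (ν + ((m + 1 : ℕ) : ℤ)) = q ^ ν * q ^ ((m + 1 : ℕ) : ℤ) := zpow_add₀ hq _ _
  rw [e2, e3, e4, e5]
  refine qPIV_of_bilinear hq hc ha (zpow_ne_zero ν hq) (zpow_ne_zero _ hq) hP₀ hP₁ hP₂ hQ₀ hQ₁ hQ₂
    hR₀ hR₁ hR₂ (W := phiBar Gb m (ν + 1) (q * c)) ?_ ?_ ?_ ?_ (hf0 c) ?_ ?_ (hf0 (q * c)) ?_ ?_
  · linear_combination h1
  · linear_combination h2
  · linear_combination h3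
  · linear_combination h4
  · rw [hf1, e1]
  · rw [hf2, zpow_neg]
  · rw [hf1, e1]
  · rw [hf2, zpow_neg]

end
end
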